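/- arXiv:1104.4870 — 2 statements merged into one kernel-verified Lean document; each statement's English description precedes it below -/
import Mathlib

section
/- For a composition ν of n, the sum over all words w of weight ν of q^{maj(w)} equals the sum over all words of weight ν of q^{inv(w)}, and both equal the q-multinomial coefficient [n choose ν]_q. -/
open Finset

/-- The canonical word of weight `ν`: `ν.get 0` letters `1`, then `ν.get 1` letters `2`, etc. -/
def canonicalWord (ν : List ℕ) : List ℕ :=
  (List.range ν.length).flatMap fun i => List.replicate (ν.getD i 0) (i + 1)

/-- The (finite) set of all words of weight `ν`, i.e. all rearrangements of the
canonical word of weight `ν`. -/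
def WordSet (ν : List ℕ) : Finset (List ℕ) :=
  (canonicalWord ν).permutations.toFinset

/-- The number of inversions of a word: pairs of positions `i < j` with `w i > w j`. -/
def invL : List ℕ → ℕ
  | [] => 0
  | a :: l => (l.countP fun b => decide (b < a)) + invL l

/-- The major index of a word: the sum of the (1-based) positions `i` with `w_i > w_{i+1}`. -/
def majL (w : List ℕ) : ℕ :=
  ∑ i ∈ Finset.range w.length,
    if w.getD (i + 1) 0 < w.getD i 0 ∧ i + 1 < w.length then i + 1 else 0

/-- The `q`-integer `[k]_q = 1 + q + ⋯ + q^{k-1}` as a rational function in `q = X`. -/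
noncomputable def qInt (k : ℕ) : RatFunc ℚ := ∑ i ∈ Finset.range k, RatFunc.X ^ i

/-- The `q`-factorial `[k]_q!`. -/
noncomputable def qFact (k : ℕ) : RatFunc ℚ := ∏ i ∈ Finset.range k, qInt (i + 1)

/-- The `q`-multinomial coefficient `[n choose ν]_q = [n]_q! / ([ν₁]_q! [ν₂]_q! ⋯)`
where `n = ν₁ + ν₂ + ⋯`. -/
noncomputable def qMultinomial (ν : List ℕ) : RatFunc ℚ :=
  qFact ν.sum / (ν.map qFact).prod

namespace MacMahon

/-- Inversions of the reversed word. -/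
def rinv : List ℕ → ℕ
  | [] => 0
  | a :: l => (l.countP fun b => decide (a < b)) + rinv l

/-- Major index of the reversed word. -/
def rmaj : List ℕ → ℕ
  | [] => 0
  | [_] => 0
  | x :: y :: l => (if x < y then l.length + 1 else 0) + rmaj (y :: l)

theorem invL_append (l : List ℕ) (x : ℕ) :
    invL (l ++ [x]) = (l.countP fun b => decide (x < b)) + invL l := by
  induction l with
  | nil => simp [invL]
  | cons a l ih =>
    simp only [List.cons_append, invL, ih, List.countP_append, List.countP_cons, List.countP_nil]
    omega

theorem invL_reverse (l : List ℕ) : invL l.reverse = rinv l := by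
  induction l with
  | nil => simp [invL, rinv]
  | cons a l ih => simp [invL_append, rinv, ih]

theorem majL_append (l : List ℕ) (y x : ℕ) :
    majL ((l ++ [y]) ++ [x]) = (if x < y then l.length + 1 else 0) + majL (l ++ [y]) := by
  unfold majL
  simp only [List.length_append, List.length_singleton]
  rw [Finset.sum_range_succ, Finset.sum_range_succ, Finset.sum_range_succ (n := l.length)]
  have h : ∀ i ∈ Finset.range l.length,
      (if (l ++ [y] ++ [x]).getD (i + 1) 0 < (l ++ [y] ++ [x]).getD i 0 ∧
        i + 1 < l.length + 1 + 1 then i + 1 else 0) =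
      (if (l ++ [y]).getD (i + 1) 0 < (l ++ [y]).getD i 0 ∧
        i + 1 < l.length + 1 then i + 1 else 0) := by
    intro i hi
    rw [Finset.mem_range] at hi
    rw [List.getD_append _ [x] _ (i + 1) (by simp; omega),
      List.getD_append _ [x] _ i (by simp; omega)]
    simp [hi, hi.le]
  rw [Finset.sum_congr rfl h]
  have h1 : (l ++ [y] ++ [x]).getD (l.length + 1) 0 = x := by
    simp [List.getD_eq_getElem?_getD]
  have h2 : (l ++ [y] ++ [x]).getD l.length 0 = y := by
    simp [List.getD_eq_getElem?_getD]
  rw [h1, h2]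
  simp
  omega

theorem majL_reverse (l : List ℕ) : majL l.reverse = rmaj l := by
  induction l with
  | nil => simp [majL, rmaj]
  | cons a l ih =>
    cases l with
    | nil => simp [majL, rmaj]
    | cons b l =>
      rw [List.reverse_cons, List.reverse_cons, majL_append, ← List.reverse_cons, ih]
      simp [rmaj]

/-- The words whose multiset of letters is `M`. -/
def words (M : Multiset ℕ) : Finset (List ℕ) := M.lists.toFinset

theorem mem_words {M : Multiset ℕ} {l : List ℕ} : l ∈ words M ↔ M = (l : Multiset ℕ) := by
  rw [words, Multiset.mem_toFinset, Multiset.mem_lists_iff]; rfl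

theorem sum_lists (M : Multiset ℕ) (hM : M ≠ 0) (f : List ℕ → RatFunc ℚ) :
    ∑ w ∈ words M, f w = ∑ x ∈ M.toFinset, ∑ w ∈ words (M.erase x), f (x :: w) := by
  rw [Finset.sum_sigma']
  symm
  refine Finset.sum_bij (fun p _ => p.1 :: p.2) ?_ ?_ ?_ ?_
  · rintro ⟨x, w⟩ h
    simp only [Finset.mem_sigma, Multiset.mem_toFinset, mem_words] at h ⊢
    rw [← Multiset.cons_erase h.1, h.2]; rfl
  · rintro ⟨x, w⟩ _ ⟨y, v⟩ _ h
    simp at h; obtain ⟨rfl, rfl⟩ := h; rfl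
  · intro w hw
    rw [mem_words] at hw
    cases w with
    | nil => exact absurd hw hM
    | cons x w =>
      refine ⟨⟨x, w⟩, ?_, rfl⟩
      subst hw
      simp [mem_words]
  · intros; rfl

theorem sum_lists_zero (f : List ℕ → RatFunc ℚ) : ∑ w ∈ words (0 : Multiset ℕ), f w = f [] := by
  have : words (0 : Multiset ℕ) = {[]} := by
    ext w; rw [mem_words]; simp [eq_comm]
  rw [this, Finset.sum_singleton]

theorem X_pow_ne (n : ℕ) : (RatFunc.X : RatFunc ℚ) ^ (n + 1) - 1 ≠ 0 := by
  rw [← RatFunc.algebraMap_X, ← map_pow, ← map_one (algebraMap (Polynomial ℚ) (RatFunc ℚ)),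
    ← map_sub]
  apply RatFunc.algebraMap_ne_zero
  have := Polynomial.X_pow_sub_C_ne_zero (R := ℚ) (Nat.succ_pos n) 1
  simpa using this

theorem X_sub_ne : (RatFunc.X : RatFunc ℚ) - 1 ≠ 0 := by simpa using X_pow_ne 0

theorem qInt_mul (n : ℕ) : qInt n * (RatFunc.X - 1) = RatFunc.X ^ n - 1 := geom_sum_mul _ _

theorem qInt_ne (n : ℕ) : qInt (n + 1) ≠ 0 := by
  intro h
  have := qInt_mul (n + 1)
  rw [h, zero_mul] at this
  exact X_pow_ne n this.symm

theorem qFact_ne (n : ℕ) : qFact n ≠ 0 := Finset.prod_ne_zero_iff.2 fun i _ => qInt_ne i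

theorem qFact_succ (n : ℕ) : qFact (n + 1) = qFact n * qInt (n + 1) := Finset.prod_range_succ _ _

/-- Multinomial of a multiset with letters below `K`. -/
noncomputable def F (K : ℕ) (M : Multiset ℕ) : RatFunc ℚ :=
  qFact M.card / ∏ y ∈ Finset.range K, qFact (M.count y)

theorem F_zero (K : ℕ) : F K 0 = 1 := by simp [F, qFact]

theorem F_erase (K : ℕ) (M : Multiset ℕ) (x : ℕ) (hx : x ∈ M) (hK : x < K) :
    F K (M.erase x) * qInt M.card = F K M * qInt (M.count x) := by
  obtain ⟨N, rfl⟩ := Multiset.exists_cons_of_mem hx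
  have hxK : x ∈ Finset.range K := Finset.mem_range.2 hK
  have e : ∏ y ∈ (Finset.range K).erase x, qFact ((x ::ₘ N).count y) =
      ∏ y ∈ (Finset.range K).erase x, qFact (N.count y) := by
    refine Finset.prod_congr rfl fun y hy => ?_
    rw [Multiset.count_cons_of_ne (Finset.ne_of_mem_erase hy)]
  have hP : ∏ y ∈ (Finset.range K).erase x, qFact (N.count y) ≠ 0 :=
    Finset.prod_ne_zero_iff.2 fun i _ => qFact_ne _
  unfold F
  rw [← Finset.mul_prod_erase _ _ hxK, ← Finset.mul_prod_erase _ _ hxK, e]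
  simp only [Multiset.erase_cons_head, Multiset.card_cons, Multiset.count_cons_self, qFact_succ]
  have h1 := qFact_ne (N.count x)
  have h2 := qInt_ne (N.count x)
  field_simp

/-- Number of letters that are at least `k`. -/
def ge (M : Multiset ℕ) (k : ℕ) : ℕ := M.countP (fun b => k ≤ b)

theorem ge_succ (M : Multiset ℕ) (k : ℕ) : ge M k = M.count k + ge M (k + 1) := by
  induction M using Multiset.induction with
  | empty => simp [ge]
  | cons a M ih =>
    simp only [ge, Multiset.countP_cons, Multiset.count_cons] at ih ⊢
    rw [ih]
    split_ifs <;> omega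

theorem ge_zero (M : Multiset ℕ) : ge M 0 = M.card := by
  simp [ge]

theorem ge_top (M : Multiset ℕ) (K : ℕ) (h : ∀ x ∈ M, x < K) : ge M K = 0 := by
  simpa [ge, Multiset.countP_eq_zero] using h

theorem term_eq (M : Multiset ℕ) (y : ℕ) :
    (RatFunc.X : RatFunc ℚ) ^ ge M (y + 1) * qInt (M.count y) * (RatFunc.X - 1) =
      RatFunc.X ^ ge M y - RatFunc.X ^ ge M (y + 1) := by
  rw [mul_assoc, qInt_mul, ge_succ M y, pow_add]; ring

/-- Telescoping identity. -/
theorem tele (M : Multiset ℕ) (K x : ℕ) (h : ∀ y ∈ M, y < K) (hx : x < K) :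
    ∑ y ∈ Finset.range K, (RatFunc.X : RatFunc ℚ) ^ (if x < y then M.card else 0) *
      (RatFunc.X ^ ge M (y + 1) * qInt (M.count y)) =
      RatFunc.X ^ ge M (x + 1) * qInt M.card := by
  apply mul_right_cancel₀ X_sub_ne
  rw [Finset.sum_mul, mul_assoc _ (qInt _), qInt_mul]
  have hs := Finset.sum_range_add_sum_Ico
    (fun y => (RatFunc.X : RatFunc ℚ) ^ (if x < y then M.card else 0) *
      (RatFunc.X ^ ge M (y + 1) * qInt (M.count y)) * (RatFunc.X - 1)) (show x + 1 ≤ K from hx)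
  rw [← hs]
  have h1 : ∑ y ∈ Finset.range (x + 1),
      (RatFunc.X : RatFunc ℚ) ^ (if x < y then M.card else 0) *
      (RatFunc.X ^ ge M (y + 1) * qInt (M.count y)) * (RatFunc.X - 1) =
      RatFunc.X ^ M.card - RatFunc.X ^ ge M (x + 1) := by
    rw [← ge_zero, ← Finset.sum_range_sub' (fun y => (RatFunc.X : RatFunc ℚ) ^ ge M y)]
    refine Finset.sum_congr rfl fun y hy => ?_
    rw [Finset.mem_range] at hy
    rw [if_neg (by omega), pow_zero, one_mul, term_eq]
  have h2 : ∑ y ∈ Finset.Ico (x + 1) K,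
      (RatFunc.X : RatFunc ℚ) ^ (if x < y then M.card else 0) *
      (RatFunc.X ^ ge M (y + 1) * qInt (M.count y)) * (RatFunc.X - 1) =
      RatFunc.X ^ M.card * (RatFunc.X ^ ge M (x + 1) - 1) := by
    have : (RatFunc.X : RatFunc ℚ) ^ ge M (x + 1) - 1 =
        ∑ y ∈ Finset.Ico (x + 1) K, (RatFunc.X ^ ge M y - RatFunc.X ^ ge M (y + 1)) := by
      have := Finset.sum_Ico_sub (fun y => (RatFunc.X : RatFunc ℚ) ^ ge M y)
        (show x + 1 ≤ K from hx)
      rw [ge_top M K h, pow_zero] at this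
      rw [← neg_inj, neg_sub, ← this, ← Finset.sum_neg_distrib]
      exact Finset.sum_congr rfl fun y _ => by ring
    rw [this, Finset.mul_sum]
    refine Finset.sum_congr rfl fun y hy => ?_
    rw [Finset.mem_Ico] at hy
    rw [if_pos (by omega), mul_assoc, term_eq]
  rw [h1, h2]
  ring

/-- The same identity weighted by multinomials. -/
theorem teleF (M : Multiset ℕ) (K x : ℕ) (h : ∀ y ∈ M, y < K) (hx : x < K) (hM : M ≠ 0) :
    ∑ y ∈ M.toFinset, (RatFunc.X : RatFunc ℚ) ^ (if x < y then M.card else 0) *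
      (RatFunc.X ^ ge M (y + 1) * F K (M.erase y)) =
      RatFunc.X ^ ge M (x + 1) * F K M := by
  obtain ⟨n, hn⟩ : ∃ n, M.card = n + 1 :=
    Nat.exists_eq_succ_of_ne_zero (by simpa using hM)
  have hq : qInt M.card ≠ 0 := hn ▸ qInt_ne n
  apply mul_right_cancel₀ hq
  rw [mul_right_comm, ← tele M K x h hx, Finset.sum_mul, Finset.sum_mul]
  have hsub : M.toFinset ⊆ Finset.range K := by
    intro y hy
    exact Finset.mem_range.2 (h y (Multiset.mem_toFinset.1 hy))
  rw [← Finset.sum_subset hsub]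
  · refine Finset.sum_congr rfl fun y hy => ?_
    rw [Multiset.mem_toFinset] at hy
    have := F_erase K M y hy (h y hy)
    rw [mul_assoc, mul_assoc, this]; ring
  · intro y _ hy
    rw [Multiset.mem_toFinset] at hy
    simp [Multiset.count_eq_zero_of_notMem hy, qInt]

theorem ge_erase (M : Multiset ℕ) (y : ℕ) (hy : y ∈ M) :
    ge (M.erase y) (y + 1) = ge M (y + 1) := by
  obtain ⟨N, rfl⟩ := Multiset.exists_cons_of_mem hy
  simp [ge]

theorem rmaj_sum (K n : ℕ) : ∀ (M : Multiset ℕ), M.card = n → (∀ y ∈ M, y < K) → ∀ x < K,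
    ∑ w ∈ words M, (RatFunc.X : RatFunc ℚ) ^ rmaj (x :: w) =
      RatFunc.X ^ ge M (x + 1) * F K M := by
  induction n with
  | zero =>
    intro M hM _ x _
    rw [Multiset.card_eq_zero] at hM
    subst hM
    rw [sum_lists_zero, F_zero]; simp [ge, rmaj]
  | succ n ih =>
    intro M hM h x hx
    have hM0 : M ≠ 0 := by rintro rfl; simp at hM
    rw [sum_lists M hM0, ← teleF M K x h hx hM0]
    refine Finset.sum_congr rfl fun y hy => ?_
    rw [Multiset.mem_toFinset] at hy
    have hc : (M.erase y).card = n := by rw [Multiset.card_erase_of_mem hy, hM]; rfl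
    rw [← ge_erase M y hy, ← ih (M.erase y) hc
      (fun z hz => h z (Multiset.mem_of_mem_erase hz)) y (h y hy), Finset.mul_sum]
    refine Finset.sum_congr rfl fun w hw => ?_
    rw [mem_words] at hw
    have hl : w.length = n := by rw [← hc, hw]; rfl
    rw [rmaj, pow_add, hl, hM]

theorem rinv_sum (K n : ℕ) : ∀ (M : Multiset ℕ), M.card = n → (∀ y ∈ M, y < K) →
    ∑ w ∈ words M, (RatFunc.X : RatFunc ℚ) ^ rinv w = F K M := by
  induction n with
  | zero =>
    intro M hM _
    rw [Multiset.card_eq_zero] at hM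
    subst hM
    rw [sum_lists_zero, F_zero]; simp [rinv]
  | succ n ih =>
    intro M hM h
    have hM0 : M ≠ 0 := by rintro rfl; simp at hM
    obtain ⟨z, hz⟩ := Multiset.exists_mem_of_ne_zero hM0
    have hK : K - 1 + 1 = K := by have := h z hz; omega
    have ht := teleF M K (K - 1) h (by omega) hM0
    rw [hK, ge_top M K h, pow_zero, one_mul] at ht
    rw [sum_lists M hM0, ← ht]
    refine Finset.sum_congr rfl fun y hy => ?_
    rw [Multiset.mem_toFinset] at hy
    have hc : (M.erase y).card = n := by rw [Multiset.card_erase_of_mem hy, hM]; rfl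
    have := h y hy
    rw [if_neg (by omega), pow_zero, one_mul, ← ge_erase M y hy, ← ih (M.erase y) hc
      (fun z hz => h z (Multiset.mem_of_mem_erase hz)), Finset.mul_sum]
    refine Finset.sum_congr rfl fun w hw => ?_
    rw [mem_words] at hw
    rw [rinv, pow_add, hw]
    rfl

theorem rmaj_cons_top (K : ℕ) (w : List ℕ) (h : ∀ y ∈ w, y < K) : rmaj (K :: w) = rmaj w := by
  cases w with
  | nil => rfl
  | cons y w =>
    have := h y (by simp)
    rw [rmaj, if_neg (by omega), zero_add]

theorem rmaj_sum' (K : ℕ) (M : Multiset ℕ) (h : ∀ y ∈ M, y < K) :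
    ∑ w ∈ words M, (RatFunc.X : RatFunc ℚ) ^ rmaj w = F (K + 1) M := by
  have := rmaj_sum (K + 1) _ M rfl (fun y hy => (h y hy).trans (Nat.lt_succ_self K)) K
    (Nat.lt_succ_self K)
  rw [ge_top M (K + 1) (fun y hy => (h y hy).trans (Nat.lt_succ_self K)), pow_zero, one_mul] at this
  rw [← this]
  refine Finset.sum_congr rfl fun w hw => ?_
  rw [mem_words] at hw
  rw [rmaj_cons_top]
  intro y hy
  exact h y (by rw [hw]; exact hy)

theorem sum_reverse (ν : List ℕ) (f : List ℕ → RatFunc ℚ) :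
    ∑ w ∈ WordSet ν, f w = ∑ w ∈ words (canonicalWord ν : Multiset ℕ), f w.reverse := by
  refine Finset.sum_nbij' List.reverse List.reverse ?_ ?_ ?_ ?_ ?_
  · intro w hw
    simp only [WordSet, List.mem_toFinset, List.mem_permutations] at hw
    rw [mem_words]
    exact Quotient.sound (hw.symm.trans (List.reverse_perm w).symm)
  · intro w hw
    rw [mem_words] at hw
    have := Multiset.coe_eq_coe.1 hw
    simp only [WordSet, List.mem_toFinset, List.mem_permutations]
    exact (List.reverse_perm w).trans this.symm
  · simp
  · simp
  · simp

theorem canonical_lt (ν : List ℕ) : ∀ y ∈ canonicalWord ν, y < ν.length + 1 := by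
  intro y hy
  simp only [canonicalWord, List.mem_flatMap, List.mem_range, List.mem_replicate] at hy
  obtain ⟨i, hi, -, rfl⟩ := hy
  omega

theorem canonical_length (ν : List ℕ) : (canonicalWord ν).length = ν.sum := by
  have : (List.range ν.length).map (fun i => ν.getD i 0) = ν := by
    apply List.ext_getElem
    · simp
    · intro i h1 h2
      simp [h2]
  rw [canonicalWord, List.length_flatMap]
  simp only [List.length_replicate]
  rw [this]

theorem canonical_count (ν : List ℕ) (y : ℕ) :
    (canonicalWord ν).count (y + 1) = ν.getD y 0 := by
  have key : ∀ n, ((List.range n).flatMap fun i => List.replicate (ν.getD i 0) (i + 1)).count (y + 1)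
      = if y < n then ν.getD y 0 else 0 := by
    intro n
    induction n with
    | zero => simp
    | succ n ih =>
      rw [List.range_succ, List.flatMap_append, List.count_append, ih]
      simp only [List.flatMap_cons, List.flatMap_nil, List.append_nil, List.count_replicate]
      by_cases h : y = n
      · subst h; simp
      · have : ¬ n = y := fun e => h e.symm
        by_cases h2 : y < n
        · simp [h2, this, Nat.lt_succ_of_lt h2]
        · have h3 : ¬ y < n + 1 := by omega
          simp [h2, h3, this]
  rw [canonicalWord, key]
  split_ifs with h
  · rfl
  · rw [List.getD_eq_default _ _ (by omega)]

theorem canonical_count_zero (ν : List ℕ) : (canonicalWord ν).count 0 = 0 := by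
  rw [List.count_eq_zero]
  simp [canonicalWord]

theorem F_canonical (ν : List ℕ) (K : ℕ) (hK : ν.length ≤ K) :
    F (K + 1) (canonicalWord ν : Multiset ℕ) = qMultinomial ν := by
  unfold F qMultinomial
  rw [Multiset.coe_card, canonical_length, Finset.prod_range_succ']
  simp only [Multiset.coe_count, canonical_count, canonical_count_zero]
  have h0 : qFact 0 = 1 := by simp [qFact]
  rw [h0, mul_one]
  congr 1
  rw [← Finset.prod_subset (Finset.range_subset_range.2 hK)]
  · rw [← Fin.prod_univ_eq_prod_range (fun i => qFact (ν.getD i 0)), ← Fin.prod_univ_fun_getElem]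
    simp
  · intro i _ hi
    rw [Finset.mem_range, not_lt] at hi
    rw [List.getD_eq_default _ _ hi, h0]

theorem main (ν : List ℕ) :
    (∑ w ∈ WordSet ν, (RatFunc.X : RatFunc ℚ) ^ majL w) = qMultinomial ν ∧
    (∑ w ∈ WordSet ν, (RatFunc.X : RatFunc ℚ) ^ invL w) = qMultinomial ν := by
  have h : ∀ y ∈ (canonicalWord ν : Multiset ℕ), y < ν.length + 1 := canonical_lt ν
  constructor
  · rw [sum_reverse]
    simp only [majL_reverse]
    rw [rmaj_sum' _ _ h, F_canonical ν _ (by omega)]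
  · rw [sum_reverse]
    simp only [invL_reverse]
    rw [rinv_sum _ _ _ rfl h, F_canonical ν _ le_rfl]

end MacMahon

/-- For a composition `ν` of `n`, the generating functions of `maj` and `inv` over all
words of weight `ν` agree, and both equal the `q`-multinomial coefficient `[n choose ν]_q`. -/
theorem stmt0 (ν : List ℕ) :
    (∑ w ∈ WordSet ν, (RatFunc.X : RatFunc ℚ) ^ majL w)
      = (∑ w ∈ WordSet ν, (RatFunc.X : RatFunc ℚ) ^ invL w) ∧
    (∑ w ∈ WordSet ν, (RatFunc.X : RatFunc ℚ) ^ invL w) = qMultinomial ν := by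
  exact ⟨(MacMahon.main ν).1.trans (MacMahon.main ν).2.symm, (MacMahon.main ν).2⟩
end

section
/- For any composition ν of n and any integers k_1,...,k_m, there exists a function α': Word(ν) → ℤ such that q^{k_1ν_1 + ··· + k_mν_m} [n choose ν]_q = Σ_{w ∈ Word(ν)} q^{n·α'(w) + maj(w)}. -/
open Finset

def rmaj : List ℕ → ℕ
  | [] => 0
  | [_] => 0
  | a :: b :: l => rmaj (b :: l) + if a < b then l.length + 1 else 0

theorem majL_concat (l : List ℕ) (b a : ℕ) :
    majL (l ++ [b] ++ [a]) = majL (l ++ [b]) + if a < b then l.length + 1 else 0 := by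
  unfold majL
  have e : (l ++ [b] ++ [a]).length = l.length + 1 + 1 := by simp
  have e2 : (l ++ [b]).length = l.length + 1 := by simp
  rw [e, e2, Finset.sum_range_succ, Finset.sum_range_succ, Finset.sum_range_succ]
  have : ∀ i ∈ Finset.range l.length,
      (if (l ++ [b] ++ [a]).getD (i + 1) 0 < (l ++ [b] ++ [a]).getD i 0 ∧ i + 1 < l.length + 1 + 1
        then i + 1 else 0)
      = (if (l ++ [b]).getD (i + 1) 0 < (l ++ [b]).getD i 0 ∧ i + 1 < l.length + 1
        then i + 1 else 0) := by
    intro i hi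
    rw [Finset.mem_range] at hi
    rw [List.getD_append _ _ _ _ (by simp; omega), List.getD_append (l ++ [b]) _ _ _ (by simp; omega)]
    have h1 : i + 1 < l.length + 1 + 1 := by omega
    have h2 : i + 1 < l.length + 1 := by omega
    simp only [h1, h2]
  rw [Finset.sum_congr rfl this]
  have x1 : (l ++ [b] ++ [a]).getD (l.length + 1) 0 = a := by simp [List.getD]
  have x2 : (l ++ [b] ++ [a]).getD l.length 0 = b := by simp [List.getD]
  rw [x1, x2]
  simp

theorem majL_reverse (w : List ℕ) : majL w.reverse = rmaj w := by
  induction w with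
  | nil => simp [majL, rmaj]
  | cons a l ih =>
    cases l with
    | nil => simp [majL, rmaj]
    | cons b l =>
      rw [List.reverse_cons, List.reverse_cons, majL_concat, rmaj, ← ih, List.reverse_cons]
      simp

theorem X_sub_one_ne : (RatFunc.X : RatFunc ℚ) - 1 ≠ 0 := by
  rw [sub_ne_zero]
  intro h
  have : (Polynomial.X : Polynomial ℚ) = 1 := by
    apply RatFunc.algebraMap_injective ℚ
    simpa using h
  have := congrArg (Polynomial.eval 0) this
  simp at this

theorem qInt_mul (k : ℕ) : qInt k * (RatFunc.X - 1) = RatFunc.X ^ k - 1 := by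
  unfold qInt
  exact geom_sum_mul _ _

theorem qInt_ne (k : ℕ) : qInt (k + 1) ≠ 0 := by
  have h : qInt (k + 1) = algebraMap (Polynomial ℚ) (RatFunc ℚ)
      (∑ i ∈ Finset.range (k + 1), Polynomial.X ^ i) := by
    simp [qInt]
  rw [h, map_ne_zero_iff _ (RatFunc.algebraMap_injective ℚ)]
  intro h
  have := congrArg (Polynomial.eval 1) h
  simp [Polynomial.eval_finsetSum] at this
  norm_cast at this

theorem qFact_ne (k : ℕ) : qFact k ≠ 0 :=
  Finset.prod_ne_zero_iff.2 fun _ _ => qInt_ne _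

theorem qFact_succ (k : ℕ) : qFact (k + 1) = qFact k * qInt (k + 1) :=
  Finset.prod_range_succ _ _

/-- number of letters at least `b` -/
def cge (s : Multiset ℕ) (b : ℕ) : ℕ := s.countP (fun x => b ≤ x)

theorem cge_succ (s : Multiset ℕ) (b : ℕ) : cge s b = cge s (b + 1) + s.count b := by
  unfold cge
  induction s using Multiset.induction with
  | empty => simp
  | cons a s ih =>
    simp only [Multiset.countP_cons, Multiset.count_cons, ih]
    split_ifs <;> omega

theorem cge_zero (s : Multiset ℕ) : cge s 0 = s.card := by
  simp [cge]

theorem cge_big (s : Multiset ℕ) (K : ℕ) (h : ∀ x ∈ s, x < K) : cge s K = 0 := by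
  simp only [cge, Multiset.countP_eq_zero]
  intro x hx
  have := h x hx
  omega

theorem cge_erase (s : Multiset ℕ) (a : ℕ) (h : a ∈ s) : cge (s.erase a) (a + 1) = cge s (a + 1) := by
  conv_rhs => rw [← Multiset.cons_erase h]
  simp [cge]

theorem tele (s : Multiset ℕ) (Q : RatFunc ℚ) (a K : ℕ) :
    (∑ b ∈ Finset.range K, (if b ≤ a then 1 else Q) * (RatFunc.X ^ cge s (b + 1) * qInt (s.count b)))
      * (RatFunc.X - 1)
    = if K ≤ a + 1 then RatFunc.X ^ cge s 0 - RatFunc.X ^ cge s K else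
      RatFunc.X ^ cge s 0 - RatFunc.X ^ cge s (a + 1) +
        Q * (RatFunc.X ^ cge s (a + 1) - RatFunc.X ^ cge s K) := by
  induction K with
  | zero => simp
  | succ K ih =>
    rw [Finset.sum_range_succ, add_mul, ih, mul_assoc, mul_assoc, qInt_mul]
    have : (RatFunc.X : RatFunc ℚ) ^ cge s (K + 1) * (RatFunc.X ^ s.count K - 1)
      = RatFunc.X ^ cge s K - RatFunc.X ^ cge s (K + 1) := by
      rw [cge_succ s K]; ring
    rw [this]
    rcases lt_trichotomy K (a + 1) with h | h | h
    · rw [if_pos (by omega), if_pos (by omega), if_pos (by omega)]; ring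
    · subst h
      rw [if_pos (by omega), if_neg (by omega), if_neg (by omega)]
    · rw [if_neg (by omega), if_neg (by omega), if_neg (by omega)]; ring

/-- words with content `s` -/
def wlists (s : Multiset ℕ) : Finset (List ℕ) := s.lists.toFinset

noncomputable def GG (s : Multiset ℕ) (a : ℕ) : RatFunc ℚ :=
  ∑ w ∈ wlists s with w.headI = a, RatFunc.X ^ rmaj w

noncomputable def FF (s : Multiset ℕ) : RatFunc ℚ :=
  ∑ w ∈ wlists s, RatFunc.X ^ rmaj w

noncomputable def DD (K : ℕ) (s : Multiset ℕ) : RatFunc ℚ :=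
  ∏ x ∈ Finset.range K, qFact (s.count x)

theorem DD_ne (K : ℕ) (s : Multiset ℕ) : DD K s ≠ 0 :=
  Finset.prod_ne_zero_iff.2 fun _ _ => qFact_ne _

theorem DD_erase (K : ℕ) (s : Multiset ℕ) (a : ℕ) (ha : a ∈ s) (hK : a < K) :
    DD K s = DD K (s.erase a) * qInt (s.count a) := by
  unfold DD
  have hm : a ∈ Finset.range K := Finset.mem_range.2 hK
  rw [← Finset.mul_prod_erase _ _ hm, ← Finset.mul_prod_erase _ _ hm]
  have : ∀ x ∈ (Finset.range K).erase a, qFact ((s.erase a).count x) = qFact (s.count x) := by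
    intro x hx
    rw [Multiset.count_erase_of_ne (Finset.ne_of_mem_erase hx)]
  rw [Finset.prod_congr rfl this, Multiset.count_erase_self]
  obtain ⟨c, hc⟩ := Nat.exists_eq_succ_of_ne_zero (Multiset.count_ne_zero.2 ha)
  rw [hc, Nat.succ_sub_one, Nat.succ_eq_add_one, qFact_succ]
  ring

theorem mem_lists' (s : Multiset ℕ) (l : List ℕ) : l ∈ wlists s ↔ s = (l : Multiset ℕ) :=
  Multiset.mem_toFinset.trans (Multiset.mem_lists_iff s l)

theorem GG_eq (s : Multiset ℕ) (a : ℕ) (ha : a ∈ s) :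
    GG s a = ∑ l ∈ wlists (s.erase a), RatFunc.X ^ rmaj (a :: l) := by
  unfold GG
  symm
  refine Finset.sum_bij (fun l _ => a :: l) ?_ ?_ ?_ ?_
  · intro l hl
    rw [mem_lists'] at hl
    rw [Finset.mem_filter, mem_lists', ← Multiset.cons_coe, ← hl, Multiset.cons_erase ha]
    simp
  · intro l _ l' _ h
    simpa using h
  · intro w hw
    rw [Finset.mem_filter, mem_lists'] at hw
    obtain ⟨h1, h2⟩ := hw
    cases w with
    | nil => rw [h1] at ha; simp at ha
    | cons b l =>
      simp only [List.headI_cons] at h2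
      subst h2
      refine ⟨l, ?_, rfl⟩
      rw [mem_lists', h1]
      simp
  · intros; rfl

theorem headI_mem (s : Multiset ℕ) (hs : s ≠ 0) (l : List ℕ) (hl : l ∈ wlists s) : l.headI ∈ s := by
  rw [mem_lists'] at hl
  cases l with
  | nil => simp_all
  | cons b l => simp [hl]

theorem GG_step (K : ℕ) (s : Multiset ℕ) (a : ℕ) (ha : a ∈ s) (ht : s.erase a ≠ 0)
    (hK : ∀ x ∈ s, x < K) :
    GG s a = ∑ b ∈ Finset.range K,
      (if b ≤ a then 1 else RatFunc.X ^ (s.erase a).card) * GG (s.erase a) b := by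
  rw [GG_eq s a ha]
  have hmaps : ∀ l ∈ wlists (s.erase a), l.headI ∈ Finset.range K := by
    intro l hl
    exact Finset.mem_range.2 (hK _ (Multiset.mem_of_mem_erase (headI_mem _ ht l hl)))
  rw [← Finset.sum_fiberwise_of_maps_to hmaps]
  refine Finset.sum_congr rfl fun b _ => ?_
  unfold GG
  rw [Finset.mul_sum]
  refine Finset.sum_congr rfl fun l hl => ?_
  rw [Finset.mem_filter, mem_lists'] at hl
  obtain ⟨h1, h2⟩ := hl
  cases l with
  | nil => exact absurd h1 ht
  | cons c l =>
    simp only [List.headI_cons] at h2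
    subst h2
    rw [rmaj, h1]
    by_cases h : a < c
    · rw [if_pos h, if_neg (by omega), pow_add, mul_comm]; simp
    · rw [if_neg h, if_pos (by omega)]; simp

theorem FF_eq (K : ℕ) (s : Multiset ℕ) (hs : s ≠ 0) (hK : ∀ x ∈ s, x < K) :
    FF s = ∑ b ∈ Finset.range K, GG s b := by
  unfold FF GG
  rw [Finset.sum_fiberwise_of_maps_to]
  intro l hl
  exact Finset.mem_range.2 (hK _ (headI_mem _ hs l hl))

theorem lists_zero : wlists (0 : Multiset ℕ) = {[]} := by
  ext l
  rw [mem_lists', Finset.mem_singleton, eq_comm]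
  simp

theorem key (K n : ℕ) : ∀ (s : Multiset ℕ), s.card = n + 1 → (∀ x ∈ s, x < K) → ∀ a,
    GG s a * DD K s = RatFunc.X ^ cge s (a + 1) * qInt (s.count a) * qFact n := by
  induction n with
  | zero =>
    intro s hs hK a
    obtain ⟨b, rfl⟩ := Multiset.card_eq_one.1 hs
    by_cases hab : a = b
    · subst hab
      rw [GG_eq _ _ (by simp), DD_erase K _ a (by simp) (hK a (by simp))]
      have : ({a} : Multiset ℕ).erase a = 0 := by simp
      rw [this, lists_zero]
      rw [← cge_erase _ a (by simp), this]
      simp [rmaj, DD, qFact, cge, qInt]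
    · have : GG {b} a = 0 := by
        apply Finset.sum_eq_zero
        intro w hw
        rw [Finset.mem_filter] at hw
        have := headI_mem _ (by simp) w hw.1
        simp at this
        omega
      rw [this, Multiset.count_eq_zero_of_notMem (by simpa using hab)]
      simp [qInt]
  | succ n ih =>
    intro s hs hK a
    by_cases ha : a ∈ s
    · have hc : (s.erase a).card = n + 1 := by rw [Multiset.card_erase_of_mem ha, hs]; rfl
      have ht : s.erase a ≠ 0 := by
        intro h; rw [h] at hc; simp at hc
      have hK' : ∀ x ∈ s.erase a, x < K := fun x hx => hK x (Multiset.mem_of_mem_erase hx)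
      rw [GG_step K s a ha ht hK, DD_erase K s a ha (hK a ha), ← mul_assoc, Finset.sum_mul]
      have e : ∀ b ∈ Finset.range K,
          (if b ≤ a then 1 else RatFunc.X ^ (s.erase a).card) * GG (s.erase a) b * DD K (s.erase a)
          = (if b ≤ a then 1 else RatFunc.X ^ (s.erase a).card) *
            (RatFunc.X ^ cge (s.erase a) (b + 1) * qInt ((s.erase a).count b)) * qFact n := by
        intro b _
        rw [mul_assoc, ih _ hc hK' b]; ring
      rw [Finset.sum_congr rfl e, ← Finset.sum_mul]
      apply mul_right_cancel₀ X_sub_one_ne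
      have t := tele (s.erase a) (RatFunc.X ^ (s.erase a).card) a K
      rw [cge_zero, cge_big _ K hK', cge_erase s a ha, hc] at t
      have q := qInt_mul (n + 1)
      rw [hc, qFact_succ]
      have haK := hK a ha
      have t' : (∑ b ∈ Finset.range K, (if b ≤ a then 1 else RatFunc.X ^ (n + 1)) *
          (RatFunc.X ^ cge (s.erase a) (b + 1) * qInt ((s.erase a).count b))) * (RatFunc.X - 1)
          = RatFunc.X ^ cge s (a + 1) * (RatFunc.X ^ (n + 1) - 1) := by
        rw [t]
        split_ifs with h
        · have : K = a + 1 := by omega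
          rw [← cge_erase s a ha, ← this, cge_big _ K hK']; ring
        · ring
      rw [← q] at t'
      linear_combination (qFact n * qInt (s.count a)) * t'
    · have : GG s a = 0 := by
        apply Finset.sum_eq_zero
        intro w hw
        rw [Finset.mem_filter] at hw
        have h := headI_mem s (by rintro rfl; simp at hs) w hw.1
        rw [hw.2] at h
        exact absurd h ha
      rw [this, Multiset.count_eq_zero_of_notMem ha]
      simp [qInt]

theorem macmahon (K : ℕ) (s : Multiset ℕ) (hK : ∀ x ∈ s, x < K) :
    FF s * DD K s = qFact s.card := by
  by_cases hs : s = 0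
  · subst hs
    simp [FF, lists_zero, DD, qFact, rmaj]
  · obtain ⟨n, hn⟩ := Nat.exists_eq_succ_of_ne_zero (fun h => hs (Multiset.card_eq_zero.1 h))
    rw [FF_eq K s hs hK, Finset.sum_mul, Finset.sum_congr rfl (fun b _ => key K n s hn hK b),
      ← Finset.sum_mul, hn, Nat.succ_eq_add_one, qFact_succ, mul_comm]
    congr 1
    apply mul_right_cancel₀ X_sub_one_ne
    have t := tele s 1 K K
    rw [if_pos (by omega), cge_big _ K hK, cge_zero, hn] at t
    rw [qInt_mul]
    simpa using t

theorem FF_shift (s : Multiset ℕ) (a : ℕ) (ha : a ∈ s) :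
    (RatFunc.X ^ s.count a - 1) * FF s = (RatFunc.X ^ s.card - 1) * FF (s.erase a) := by
  obtain ⟨K, hK⟩ : ∃ K, ∀ x ∈ s, x < K := ⟨s.sum + 1, fun x hx =>
    Nat.lt_succ_of_le (Multiset.le_sum_of_mem hx)⟩
  have m1 := macmahon K s hK
  have m2 := macmahon K (s.erase a) (fun x hx => hK x (Multiset.mem_of_mem_erase hx))
  have hc := Multiset.card_erase_add_one ha
  rw [← hc, qFact_succ, DD_erase K s a ha (hK a ha), ← m2] at m1
  apply mul_right_cancel₀ (DD_ne K (s.erase a))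
  rw [← hc, ← qInt_mul, ← qInt_mul]
  linear_combination (RatFunc.X - 1) * m1

theorem fiber_perm {α : Type*} {γ : Type*} [DecidableEq γ] (A : Finset α) (f g : α → γ)
    (h : ∀ c, (A.filter (fun a => f a = c)).card = (A.filter (fun a => g a = c)).card) :
    ∃ e : A ≃ A, ∀ a : A, g (e a) = f a := by
  have E : ∀ c, Nonempty ({a : A // f a = c} ≃ {a : A // g a = c}) := by
    intro c
    refine ⟨Fintype.equivOfCardEq ?_⟩
    rw [Fintype.card_subtype, Fintype.card_subtype, Finset.card_filter, Finset.card_filter,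
      Finset.sum_coe_sort A (fun a => if f a = c then 1 else 0),
      Finset.sum_coe_sort A (fun a => if g a = c then 1 else 0),
      ← Finset.card_filter, ← Finset.card_filter, h c]
  have E := fun c => (E c).some
  exact ⟨Equiv.ofFiberEquiv E, fun a => Equiv.ofFiberEquiv_map E a⟩

noncomputable def FP (s : Multiset ℕ) : Polynomial ℚ :=
  ∑ w ∈ wlists s, Polynomial.X ^ rmaj w

theorem FP_map (s : Multiset ℕ) : algebraMap (Polynomial ℚ) (RatFunc ℚ) (FP s) = FF s := by
  simp [FP, FF]

theorem FP_shift (s : Multiset ℕ) (a : ℕ) (ha : a ∈ s) :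
    (Polynomial.X ^ s.count a - 1) * FP s = (Polynomial.X ^ s.card - 1) * FP (s.erase a) := by
  apply RatFunc.algebraMap_injective ℚ
  simpa [FP_map] using FF_shift s a ha

noncomputable def PH (s : Multiset ℕ) : AddMonoidAlgebra ℚ (ZMod s.card) :=
  ∑ w ∈ wlists s, AddMonoidAlgebra.single (rmaj w : ZMod s.card) 1

theorem PH_shift (s : Multiset ℕ) (a : ℕ) :
    AddMonoidAlgebra.single (s.count a : ZMod s.card) 1 * PH s = PH s := by
  by_cases ha : a ∈ s
  · have h := congrArg (Polynomial.aeval (AddMonoidAlgebra.single (1 : ZMod s.card) (1 : ℚ)))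
      (FP_shift s a ha)
    have e : Polynomial.aeval (AddMonoidAlgebra.single (1 : ZMod s.card) (1 : ℚ)) (FP s) = PH s := by
      simp [FP, PH, AddMonoidAlgebra.single_pow]
    rw [map_mul, map_mul, e] at h
    simp only [map_sub, map_pow, Polynomial.aeval_X, map_one, AddMonoidAlgebra.single_pow, one_pow,
      nsmul_eq_mul, mul_one, CharP.cast_eq_zero] at h
    rw [← AddMonoidAlgebra.one_def, sub_self, zero_mul, sub_mul, one_mul, sub_eq_zero] at h
    exact h
  · rw [Multiset.count_eq_zero_of_notMem ha, Nat.cast_zero, ← AddMonoidAlgebra.one_def, one_mul]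

/-- the stabilizer of `PH s` -/
noncomputable def stab (s : Multiset ℕ) : AddSubgroup (ZMod s.card) where
  carrier := {x | AddMonoidAlgebra.single x 1 * PH s = PH s}
  zero_mem' := by
    change AddMonoidAlgebra.single 0 1 * PH s = PH s
    rw [← AddMonoidAlgebra.one_def, one_mul]
  add_mem' := by
    intro x y hx hy
    change AddMonoidAlgebra.single (x + y) 1 * PH s = PH s
    change AddMonoidAlgebra.single x 1 * PH s = PH s at hx
    change AddMonoidAlgebra.single y 1 * PH s = PH s at hy
    have : (AddMonoidAlgebra.single (x + y) 1 : AddMonoidAlgebra ℚ (ZMod s.card))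
      = AddMonoidAlgebra.single x 1 * AddMonoidAlgebra.single y 1 := by
      rw [AddMonoidAlgebra.single_mul_single, one_mul]
    rw [this, mul_assoc, hy, hx]
  neg_mem' := by
    intro x hx
    change AddMonoidAlgebra.single (-x) 1 * PH s = PH s
    change AddMonoidAlgebra.single x 1 * PH s = PH s at hx
    conv_lhs => rw [← hx]
    rw [← mul_assoc, AddMonoidAlgebra.single_mul_single, neg_add_cancel, one_mul,
      ← AddMonoidAlgebra.one_def, one_mul]

theorem stab_card (s : Multiset ℕ) (x : ZMod s.card) (hx : x ∈ stab s) (c : ZMod s.card) :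
    ((wlists s).filter (fun w => (rmaj w : ZMod s.card) = c)).card
      = ((wlists s).filter (fun w => x + (rmaj w : ZMod s.card) = c)).card := by
  change AddMonoidAlgebra.single x 1 * PH s = PH s at hx
  unfold PH at hx
  rw [Finset.mul_sum] at hx
  simp only [AddMonoidAlgebra.single_mul_single, one_mul] at hx
  have h := congrArg (fun f : AddMonoidAlgebra ℚ (ZMod s.card) => f.coeff c) hx
  simp [AddMonoidAlgebra.coeff_sum, Finsupp.finsetSum_apply, Finsupp.single_apply] at h
  exact_mod_cast h.symm

theorem exists_h (s : Multiset ℕ) (S : ℤ) (hS : (S : ZMod s.card) ∈ stab s) :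
    ∃ h : List ℕ → ℤ, (RatFunc.X : RatFunc ℚ) ^ S * FF s
      = ∑ w ∈ wlists s, (RatFunc.X : RatFunc ℚ) ^ ((s.card : ℤ) * h w + rmaj w) := by
  obtain ⟨e, he⟩ := fiber_perm (wlists s) (fun w => (rmaj w : ZMod s.card))
    (fun w => (S : ZMod s.card) + (rmaj w : ZMod s.card)) (stab_card s _ hS)
  have H : ∀ w : wlists s, ∃ k : ℤ, (s.card : ℤ) * k + rmaj w.1 = S + rmaj (e w).1 := by
    intro w
    have h := he w
    have h2 : ((S + rmaj (e w).1 - rmaj w.1 : ℤ) : ZMod s.card) = 0 := by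
      push_cast
      rw [h, sub_self]
    rw [ZMod.intCast_zmod_eq_zero_iff_dvd] at h2
    obtain ⟨k, hk⟩ := h2
    exact ⟨k, by rw [← hk]; ring⟩
  choose k hk using H
  refine ⟨fun w => if h : w ∈ wlists s then k ⟨w, h⟩ else 0, ?_⟩
  rw [← Finset.sum_coe_sort (wlists s)]
  have : ∀ w : wlists s, (RatFunc.X : RatFunc ℚ) ^ ((s.card : ℤ) *
      (if h : w.1 ∈ wlists s then k ⟨w.1, h⟩ else 0) + rmaj w.1)
      = RatFunc.X ^ S * RatFunc.X ^ rmaj (e w).1 := by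
    intro w
    rw [dif_pos w.2, hk w, zpow_add₀ RatFunc.X_ne_zero, zpow_natCast]
  rw [Finset.sum_congr rfl (fun w _ => this w), ← Finset.mul_sum,
    Equiv.sum_comp e (fun w : wlists s => (RatFunc.X : RatFunc ℚ) ^ rmaj w.1),
    Finset.sum_coe_sort (wlists s) (fun w => (RatFunc.X : RatFunc ℚ) ^ rmaj w), FF]

theorem count_canon (ν : List ℕ) (i : ℕ) : (canonicalWord ν).count (i + 1) = ν.getD i 0 := by
  unfold canonicalWord
  rw [List.count_flatMap]
  have : ∀ m, (List.map (List.count (i + 1) ∘ fun i => List.replicate (ν.getD i 0) (i + 1))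
      (List.range m)).sum = if i < m then ν.getD i 0 else 0 := by
    intro m
    induction m with
    | zero => simp
    | succ m ih =>
      rw [List.range_succ, List.map_append, List.sum_append, ih]
      simp only [List.map_cons, List.map_nil, List.sum_cons, List.sum_nil, Function.comp,
        List.count_replicate]
      rcases lt_trichotomy i m with h | h | h
      · have h1 : (m + 1 == i + 1) = false := by simp; omega
        have h2 : i < m + 1 := by omega
        simp only [h1, if_pos h, if_pos h2]; simp
      · subst h; simp
      · have h1 : (m + 1 == i + 1) = false := by simp; omega
        have h2 : ¬ i < m + 1 := by omega
        have h3 : ¬ i < m := by omega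
        simp only [h1, if_neg h3, if_neg h2]; simp
  rw [this]
  split_ifs with h
  · rfl
  · rw [List.getD_eq_default _ _ (by omega)]

theorem mem_canon (ν : List ℕ) (x : ℕ) (hx : x ∈ canonicalWord ν) : x < ν.length + 1 ∧ x ≠ 0 := by
  simp [canonicalWord] at hx
  omega

theorem map_range_getD (ν : List ℕ) : (List.range ν.length).map (fun i => ν.getD i 0) = ν := by
  apply List.ext_getElem
  · simp
  · intro i h1 h2
    simp [h2]

theorem length_canon (ν : List ℕ) : (canonicalWord ν).length = ν.sum := by
  unfold canonicalWord
  rw [List.length_flatMap]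
  simp only [List.length_replicate]
  rw [map_range_getD]

theorem DD_canon (ν : List ℕ) :
    DD (ν.length + 1) (canonicalWord ν : Multiset ℕ) = (ν.map qFact).prod := by
  unfold DD
  rw [Finset.prod_range_succ']
  have h0 : (canonicalWord ν : Multiset ℕ).count 0 = 0 := by
    rw [Multiset.count_eq_zero]
    intro h
    exact (mem_canon ν 0 (by simpa using h)).2 rfl
  rw [h0]
  simp only [Multiset.coe_count, count_canon]
  conv_rhs => rw [← map_range_getD ν, List.map_map, ]
  rw [← List.prod_toFinset]
  · rw [List.toFinset_range]
    simp [qFact, Function.comp_def]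
  · exact List.nodup_range

theorem stmt5 (ν : List ℕ) (ks : List ℤ) (hk : ks.length = ν.length) :
    ∃ h : List ℕ → ℤ,
      (RatFunc.X : RatFunc ℚ) ^ (∑ i ∈ Finset.range ν.length, ks.getD i 0 * (ν.getD i 0 : ℤ))
          * qMultinomial ν
        = ∑ w ∈ WordSet ν, (RatFunc.X : RatFunc ℚ) ^ ((ν.sum : ℤ) * h w + majL w) := by
  set s : Multiset ℕ := (canonicalWord ν : Multiset ℕ) with hs
  have hcard : s.card = ν.sum := by rw [hs, Multiset.coe_card, length_canon]
  have hF : qMultinomial ν = FF s := by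
    unfold qMultinomial
    rw [← DD_canon, ← hcard, div_eq_iff (DD_ne _ _)]
    exact (macmahon _ s fun x hx => (mem_canon ν x (by simpa [hs] using hx)).1).symm
  have hS : ((∑ i ∈ Finset.range ν.length, ks.getD i 0 * (ν.getD i 0 : ℤ) : ℤ) : ZMod s.card)
      ∈ stab s := by
    rw [Int.cast_sum]
    refine AddSubgroup.sum_mem _ fun i _ => ?_
    have h1 : ((ν.getD i 0 : ℕ) : ZMod s.card) ∈ stab s := by
      rw [← count_canon ν i, ← Multiset.coe_count]
      exact PH_shift s (i + 1)
    have := AddSubgroup.zsmul_mem _ h1 (ks.getD i 0)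
    rw [zsmul_eq_mul] at this
    exact_mod_cast this
  obtain ⟨h, hh⟩ := exists_h s _ hS
  refine ⟨fun w => h w.reverse, ?_⟩
  rw [hF, hh, hcard]
  have hW : ∀ w, w ∈ wlists s ↔ w.Perm (canonicalWord ν) := by
    intro w
    rw [mem_lists', hs, Multiset.coe_eq_coe, List.perm_comm]
  have hW' : ∀ w, w ∈ WordSet ν ↔ w.Perm (canonicalWord ν) := by
    intro w
    simp [WordSet]
  refine Finset.sum_nbij' List.reverse List.reverse ?_ ?_ ?_ ?_ ?_
  · intro w hw
    rw [hW] at hw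
    rw [hW']
    exact (List.reverse_perm w).trans hw
  · intro w hw
    rw [hW'] at hw
    rw [hW]
    exact (List.reverse_perm w).trans hw
  · simp
  · simp
  · intro w _
    simp only [List.reverse_reverse, majL_reverse]
end
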